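/- arXiv:2501.00845 — 4 statements merged into one kernel-verified Lean document; each statement's English description precedes it below -/
import Mathlib

section
/- Let G be a group that is the normal closure of a finitely generated subgroup of itself and that possesses a maximal normal subgroup. Then the set 𝒩⁺(G) of proper normal subgroups of G, endowed with the coarse lower topology (as a subspace of 𝒩(G)), is a spectral space; that is, 𝒩⁺(G) is quasi-compact, T0, every irreducible closed subset is the closure of a point (sober), and it admits a basis of quasi-compact open subsets that is closed under finite intersections. -/
open TopologicalSpace

/-- The set of normal subgroups of a group `G`. -/
abbrev NormalSubgroup (G : Type*) [Group G] := {N : Subgroup G // N.Normal}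

/-- The subbasic closed set `V(S) = {N ∈ 𝒩(G) : S ⊆ N}`. -/
def VSet {G : Type*} [Group G] (S : NormalSubgroup G) : Set (NormalSubgroup G) :=
  {N | (S : Subgroup G) ≤ (N : Subgroup G)}

/-- The coarse lower topology on `𝒩(G)`: closed sets are generated by the
subbasis of sets `V(S)`, `S ∈ 𝒩(G)`. -/
instance coarseLowerTopology (G : Type*) [Group G] : TopologicalSpace (NormalSubgroup G) :=
  generateFrom {U | ∃ S : NormalSubgroup G, U = (VSet S)ᶜ}

/-- The set `𝒩⁺(G)` of proper normal subgroups, with the subspace topology. -/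
abbrev ProperNormalSubgroup (G : Type*) [Group G] :=
  {N : NormalSubgroup G // N.1 ≠ ⊤}

/-- A topological space is spectral if it is quasi-compact, T0, sober
(every irreducible closed subset is the closure of a unique point), and admits
a basis of quasi-compact open subsets that is closed under finite intersections. -/
def IsSpectralSpace (X : Type*) [TopologicalSpace X] : Prop :=
  CompactSpace X ∧ T0Space X ∧
    (∀ s : Set X, IsIrreducible s → IsClosed s → ∃! x : X, closure {x} = s) ∧
    ∃ B : Set (Set X), IsTopologicalBasis B ∧ (∀ U ∈ B, IsCompact U) ∧
      ∀ U ∈ B, ∀ V ∈ B, U ∩ V ∈ B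

namespace ProperNormalSubgroup

variable {G : Type*} [Group G]

/-- The proper normal subgroups of `G` that contain no element of `F`. -/
def avoiding (F : Finset G) : Set (ProperNormalSubgroup G) :=
  {N | ∀ g ∈ F, g ∉ N.1.1}

theorem isOpen_avoiding_singleton (g : G) : IsOpen (avoiding ({g} : Finset G)) := by
  let S : NormalSubgroup G := ⟨Subgroup.normalClosure {g}, inferInstance⟩
  refine ⟨(VSet S)ᶜ, isOpen_generateFrom_of_mem ⟨S, rfl⟩, ?_⟩
  ext N
  have := N.1.2
  have key : Subgroup.normalClosure {g} ≤ N.1.1 ↔ g ∈ N.1.1 :=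
    Subgroup.normalClosure_subset_iff.symm.trans Set.singleton_subset_iff
  simpa [avoiding, VSet, S] using not_congr key

theorem isOpen_avoiding (F : Finset G) : IsOpen (avoiding F) := by
  have h : avoiding F = ⋂ g ∈ F, avoiding {g} := by
    ext N
    simp [avoiding]
  rw [h]
  exact isOpen_biInter_finset fun g _ => isOpen_avoiding_singleton g

theorem avoiding_inter_avoiding [DecidableEq G] (F F' : Finset G) :
    avoiding F ∩ avoiding F' = avoiding (F ∪ F') := by
  ext N
  simp only [avoiding, Set.mem_inter_iff, Set.mem_ofPred_eq, Finset.mem_union]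
  grind

theorem isTopologicalBasis_range_avoiding :
    IsTopologicalBasis (Set.range (avoiding : Finset G → Set (ProperNormalSubgroup G))) := by
  classical
  refine isTopologicalBasis_of_isOpen_of_nhds ?_ ?_
  · rintro _ ⟨F, rfl⟩
    exact isOpen_avoiding F
  · rintro N _ hN ⟨V, hV, rfl⟩
    suffices h : ∃ F : Finset G, N ∈ avoiding F ∧ avoiding F ⊆ Subtype.val ⁻¹' V from
      let ⟨F, hF⟩ := h
      ⟨_, ⟨F, rfl⟩, hF⟩
    induction hV with
    | basic U hU =>
      obtain ⟨S, rfl⟩ := hU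
      have hSN : ¬ S.1 ≤ N.1.1 := hN
      obtain ⟨g, hgS, hgN⟩ := SetLike.not_le_iff_exists.mp hSN
      refine ⟨{g}, by simpa [avoiding] using hgN, fun M hM hSM => ?_⟩
      exact hM g (Finset.mem_singleton_self g) (hSM hgS)
    | univ => exact ⟨∅, by simp [avoiding], fun _ _ => trivial⟩
    | inter U V _ _ ihU ihV =>
      obtain ⟨F, hF, hFU⟩ := ihU hN.1
      obtain ⟨F', hF', hFV⟩ := ihV hN.2
      refine ⟨F ∪ F', ?_, ?_⟩ <;> rw [← avoiding_inter_avoiding]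
      · exact ⟨hF, hF'⟩
      · exact fun M hM => ⟨hFU hM.1, hFV hM.2⟩
    | sUnion C _ ih =>
      obtain ⟨U, hU, hNU⟩ := hN
      obtain ⟨F, hF, hFU⟩ := ih U hU hNU
      exact ⟨F, hF, fun M hM => ⟨U, hU, hFU hM⟩⟩

/-- The limit of a filter of normal subgroups: the elements that eventually belong to them. -/
def eventualSubgroup (f : Filter (ProperNormalSubgroup G)) : Subgroup G where
  carrier := {g | ∀ᶠ N in f, g ∈ N.1.1}
  one_mem' := Filter.Eventually.of_forall fun N => N.1.1.one_mem
  mul_mem' ha hb := by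
    filter_upwards [ha, hb] with N using N.1.1.mul_mem
  inv_mem' ha := by
    filter_upwards [ha] with N using N.1.1.inv_mem

theorem mem_eventualSubgroup {f : Filter (ProperNormalSubgroup G)} {g : G} :
    g ∈ eventualSubgroup f ↔ ∀ᶠ N in f, g ∈ N.1.1 :=
  Iff.rfl

theorem eventualSubgroup_normal (f : Filter (ProperNormalSubgroup G)) :
    (eventualSubgroup f).Normal where
  conj_mem n hn g := by
    filter_upwards [mem_eventualSubgroup.mp hn] with N hN using N.1.2.conj_mem n hN g

theorem eventualSubgroup_ne_top {T : Finset G}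
    (hT : Subgroup.normalClosure (T : Set G) = ⊤)
    (f : Filter (ProperNormalSubgroup G)) [f.NeBot] : eventualSubgroup f ≠ ⊤ := by
  intro h
  have hev : ∀ᶠ N in f, ∀ g ∈ T, g ∈ N.1.1 :=
    (Filter.eventually_all_finset T).mpr fun g _ =>
      mem_eventualSubgroup.mp (h ▸ Subgroup.mem_top g)
  obtain ⟨N, hN⟩ := hev.exists
  have := N.1.2
  exact N.2 (top_le_iff.mp (hT.symm.le.trans (Subgroup.normalClosure_le_normal hN)))

theorem isCompact_avoiding {T : Finset G}
    (hT : Subgroup.normalClosure (T : Set G) = ⊤) (F : Finset G) :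
    IsCompact (avoiding F) := by
  rw [isCompact_iff_ultrafilter_le_nhds]
  intro f hf
  rw [Filter.le_principal_iff] at hf
  refine ⟨⟨⟨eventualSubgroup f, eventualSubgroup_normal _⟩, eventualSubgroup_ne_top hT _⟩,
    fun g hgF hg => ?_, ?_⟩
  · obtain ⟨N, hgN, hN⟩ := ((mem_eventualSubgroup.mp hg).and hf).exists
    exact hN g hgF hgN
  · rw [isTopologicalBasis_range_avoiding.nhds_hasBasis.ge_iff]
    rintro _ ⟨⟨F', rfl⟩, hF'⟩
    exact (Filter.eventually_all_finset F').mpr fun g hg =>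
      Ultrafilter.eventually_not.mpr (hF' g hg)

theorem mem_closure_singleton {M N : ProperNormalSubgroup G} :
    M ∈ closure {N} ↔ N.1.1 ≤ M.1.1 := by
  rw [isTopologicalBasis_range_avoiding.mem_closure_iff]
  constructor
  · intro h g hgN
    by_contra hgM
    obtain ⟨_, hN, rfl⟩ := h (avoiding {g}) ⟨_, rfl⟩ (by simpa [avoiding] using hgM)
    exact hN g (Finset.mem_singleton_self g) hgN
  · rintro h _ ⟨F, rfl⟩ hM
    exact ⟨N, fun g hg hgN => hM g hg (h hgN), rfl⟩

instance : T0Space (ProperNormalSubgroup G) where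
  t0 M N h := by
    have hMN := mem_closure_singleton.mp (specializes_iff_mem_closure.mp h.specializes)
    have hNM := mem_closure_singleton.mp (specializes_iff_mem_closure.mp h.symm.specializes)
    exact Subtype.ext (Subtype.ext (le_antisymm hMN hNM))

theorem exists_closure_singleton_eq {s : Set (ProperNormalSubgroup G)}
    (hs : IsIrreducible s) (hc : IsClosed s) : ∃ N, closure {N} = s := by
  classical
  let K : Subgroup G := ⨅ M ∈ s, M.1.1
  have hK {g : G} : g ∈ K ↔ ∀ M ∈ s, g ∈ M.1.1 := by
    simp only [K, Subgroup.mem_iInf]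
  have hKn : K.Normal := ⟨fun n hn g => hK.mpr fun M hM => M.1.2.conj_mem n (hK.mp hn M hM) g⟩
  have hle {M : ProperNormalSubgroup G} (hM : M ∈ s) : K ≤ M.1.1 := fun _ hg => hK.mp hg M hM
  obtain ⟨M₀, hM₀⟩ := hs.nonempty
  let N : ProperNormalSubgroup G :=
    ⟨⟨K, hKn⟩, fun h => M₀.2 (top_le_iff.mp (h.symm.le.trans (hle hM₀)))⟩
  have hNs : N ∈ s := by
    rw [← hc.closure_eq, isTopologicalBasis_range_avoiding.mem_closure_iff]
    rintro _ ⟨F, rfl⟩ hNF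
    obtain ⟨M, hMs, hM⟩ := isIrreducible_iff_sInter.mp hs
      (F.image fun g => avoiding {g})
      (by simpa using fun g _ => isOpen_avoiding_singleton g)
      (by
        simp only [Finset.mem_image, forall_exists_index, and_imp, forall_apply_eq_imp_iff₂]
        intro g hg
        have hgK : g ∉ K := hNF g hg
        rw [hK] at hgK
        push Not at hgK
        obtain ⟨M, hM, hgM⟩ := hgK
        exact ⟨M, hM, by simpa [avoiding] using hgM⟩)
    refine ⟨M, fun g hg => ?_, hMs⟩
    exact hM _ (Finset.mem_coe.mpr (Finset.mem_image_of_mem _ hg)) g (Finset.mem_singleton_self g)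
  refine ⟨N, (hc.closure_subset_iff.mpr (Set.singleton_subset_iff.mpr hNs)).antisymm ?_⟩
  exact fun M hM => mem_closure_singleton.mpr (hle hM)

end ProperNormalSubgroup

/-- If `G` is the normal closure of a finitely generated subgroup of itself and has a
maximal normal subgroup, then `𝒩⁺(G)` with the coarse lower topology is spectral. -/
theorem properNormalSubgroups_isSpectralSpace (G : Type*) [Group G]
    (hfg : ∃ T : Finset G, Subgroup.normalClosure (T : Set G) = ⊤)
    (hmax : ∃ M : Subgroup G, M.Normal ∧ M ≠ ⊤ ∧
      ∀ N : Subgroup G, N.Normal → N ≠ ⊤ → M ≤ N → N = M) :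
    IsSpectralSpace (ProperNormalSubgroup G) := by
  classical
  obtain ⟨T, hT⟩ := hfg
  refine ⟨⟨?_⟩, inferInstance, fun s hs hc => ?_, _,
    ProperNormalSubgroup.isTopologicalBasis_range_avoiding, ?_, ?_⟩
  · simpa [ProperNormalSubgroup.avoiding] using ProperNormalSubgroup.isCompact_avoiding hT ∅
  · obtain ⟨N, hN⟩ := ProperNormalSubgroup.exists_closure_singleton_eq hs hc
    exact ⟨N, hN, fun M hM => (inseparable_iff_closure_eq.mpr (hM.trans hN.symm)).eq⟩
  · rintro _ ⟨F, rfl⟩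
    exact ProperNormalSubgroup.isCompact_avoiding hT F
  · rintro _ ⟨F, rfl⟩ _ ⟨F', rfl⟩
    exact ⟨_, (ProperNormalSubgroup.avoiding_inter_avoiding F F').symm⟩
end

section
/- For any group G, the set 𝒩(G) of all normal subgroups of G, endowed with the coarse lower topology, is a spectral space: it is quasi-compact, T0, sober, and admits a basis of quasi-compact open subsets closed under finite intersections. -/
open TopologicalSpace

namespace NormalSubgroup

variable {G : Type*} [Group G]

/-- The set of normal subgroups that do not contain `g`. -/
def avoiding (g : G) : Set (NormalSubgroup G) := {N | g ∉ N.1}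

@[simp]
theorem mem_avoiding {g : G} {N : NormalSubgroup G} : N ∈ avoiding g ↔ g ∉ N.1 := Iff.rfl

theorem isOpen_avoiding (g : G) : IsOpen (avoiding g) := by
  refine isOpen_generateFrom_of_mem
    ⟨⟨Subgroup.normalClosure {g}, Subgroup.normalClosure_normal⟩, ?_⟩
  ext N
  have := N.2
  simp [VSet, ← Subgroup.normalClosure_subset_iff]

theorem topology_eq_generateFrom_avoiding :
    coarseLowerTopology G = generateFrom (Set.range avoiding) := by
  refine le_antisymm (le_generateFrom ?_) (le_generateFrom ?_)
  · rintro _ ⟨g, rfl⟩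
    exact isOpen_avoiding g
  · rintro _ ⟨S, rfl⟩
    have h : (VSet S)ᶜ = ⋃ g ∈ S.1, avoiding g := by
      ext N
      simpa [VSet] using SetLike.not_le_iff_exists (p := S.1) (q := N.1)
    rw [h]
    let := generateFrom (Set.range (avoiding (G := G)))
    exact isOpen_biUnion fun g _ => isOpen_generateFrom_of_mem ⟨g, rfl⟩

/-- The finite intersections of the sets `avoiding g`. -/
def avoidingBasis (G : Type*) [Group G] : Set (Set (NormalSubgroup G)) :=
  (fun f => ⋂₀ f) '' {f | f.Finite ∧ f ⊆ Set.range avoiding}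

theorem isTopologicalBasis_avoidingBasis : IsTopologicalBasis (avoidingBasis G) :=
  isTopologicalBasis_of_subbasis topology_eq_generateFrom_avoiding

theorem inter_mem_avoidingBasis {U V : Set (NormalSubgroup G)} (hU : U ∈ avoidingBasis G)
    (hV : V ∈ avoidingBasis G) : U ∩ V ∈ avoidingBasis G := by
  obtain ⟨f, ⟨hf, hf'⟩, rfl⟩ := hU
  obtain ⟨k, ⟨hk, hk'⟩, rfl⟩ := hV
  exact ⟨f ∪ k, ⟨hf.union hk, Set.union_subset hf' hk'⟩, Set.sInter_union f k⟩

/-- The normal subgroup of the elements that belong to `F`-almost every normal subgroup. -/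
def limit (F : Filter (NormalSubgroup G)) : NormalSubgroup G where
  val :=
    { carrier := {g | ∀ᶠ N in F, g ∈ N.1}
      mul_mem' := fun ha hb => by
        filter_upwards [ha, hb] with N h₁ h₂ using mul_mem h₁ h₂
      one_mem' := Filter.Eventually.of_forall fun N => one_mem N.1
      inv_mem' := fun ha => by
        filter_upwards [ha] with N h using inv_mem h }
  property := ⟨fun n hn g => by
    filter_upwards [hn] with N h using N.2.conj_mem n h g⟩

theorem limit_mem_avoiding {F : Ultrafilter (NormalSubgroup G)} {g : G} :
    limit (F : Filter (NormalSubgroup G)) ∈ avoiding g ↔ avoiding g ∈ F :=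
  Ultrafilter.eventually_not.symm

theorem ultrafilter_le_nhds_limit (F : Ultrafilter (NormalSubgroup G)) :
    (F : Filter (NormalSubgroup G)) ≤ nhds (limit (F : Filter (NormalSubgroup G))) := by
  rw [topology_eq_generateFrom_avoiding, nhds_generateFrom]
  refine le_iInf₂ fun U hU => ?_
  obtain ⟨hU, g, rfl⟩ := hU
  exact Filter.le_principal_iff.2 (limit_mem_avoiding.1 hU)

theorem isCompact_of_mem_avoidingBasis {U : Set (NormalSubgroup G)} (hU : U ∈ avoidingBasis G) :
    IsCompact U := by
  obtain ⟨f, ⟨-, hf⟩, rfl⟩ := hU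
  refine isCompact_iff_ultrafilter_le_nhds.2 fun F hF => ⟨_, ?_, ultrafilter_le_nhds_limit F⟩
  intro u hu
  obtain ⟨g, rfl⟩ := hf hu
  exact limit_mem_avoiding.2 (Filter.mem_of_superset (Filter.le_principal_iff.1 hF)
    (Set.sInter_subset_of_mem hu))

instance : CompactSpace (NormalSubgroup G) :=
  ⟨isCompact_of_mem_avoidingBasis ⟨∅, ⟨Set.finite_empty, Set.empty_subset _⟩, Set.sInter_empty⟩⟩

theorem closure_singleton (M : NormalSubgroup G) : closure {M} = VSet M := by
  refine subset_antisymm (closure_minimal ?_ ?_) fun N hN => ?_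
  · exact Set.singleton_subset_iff.2 (le_refl M.1)
  · exact ⟨isOpen_generateFrom_of_mem ⟨M, rfl⟩⟩
  · refine isTopologicalBasis_avoidingBasis.mem_closure_iff.2 ?_
    rintro _ ⟨f, ⟨-, hf⟩, rfl⟩ hNf
    refine ⟨M, fun u hu => ?_, rfl⟩
    have hNu := hNf u hu
    obtain ⟨g, rfl⟩ := hf hu
    exact fun hg => hNu (hN hg)

theorem closure_singleton_injective :
    Function.Injective fun M : NormalSubgroup G => closure {M} := by
  intro M N h
  simp only [closure_singleton] at h
  have hM : M ∈ VSet N := h ▸ le_refl M.1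
  have hN : N ∈ VSet M := h ▸ le_refl N.1
  exact Subtype.ext (le_antisymm hN hM)

instance : T0Space (NormalSubgroup G) :=
  ⟨fun _ _ h => closure_singleton_injective (inseparable_iff_closure_eq.1 h)⟩

theorem exists_closure_singleton_eq {s : Set (NormalSubgroup G)} (hs : IsIrreducible s)
    (hc : IsClosed s) : ∃ M : NormalSubgroup G, closure {M} = s := by
  let M : NormalSubgroup G := ⟨⨅ N ∈ s, N.1,
    Subgroup.normal_iInf_normal fun N => Subgroup.normal_iInf_normal fun _ => N.2⟩
  have hM : M ∈ s := by
    rw [← hc.closure_eq]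
    refine isTopologicalBasis_avoidingBasis.mem_closure_iff.2 ?_
    rintro _ ⟨f, ⟨hf, hf'⟩, rfl⟩ hMf
    lift f to Finset (Set (NormalSubgroup G)) using hf
    rw [Set.inter_comm]
    refine isIrreducible_iff_sInter.1 hs f (fun u hu => ?_) fun u hu => ?_
    · obtain ⟨g, rfl⟩ := hf' hu
      exact isOpen_avoiding g
    · have hMu := hMf u hu
      obtain ⟨g, rfl⟩ := hf' hu
      simpa [M, Subgroup.mem_iInf, Set.Nonempty] using hMu
  refine ⟨M, subset_antisymm (closure_minimal (Set.singleton_subset_iff.2 hM) hc) fun N hN => ?_⟩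
  rw [closure_singleton]
  exact iInf₂_le (f := fun (N : NormalSubgroup G) (_ : N ∈ s) => N.1) N hN

end NormalSubgroup

/-- For any group `G`, the set `𝒩(G)` of all normal subgroups endowed with the coarse
lower topology is a spectral space. -/
theorem normalSubgroups_isSpectralSpace (G : Type*) [Group G] :
    IsSpectralSpace (NormalSubgroup G) := by
  refine ⟨inferInstance, inferInstance, fun s hs hc => ?_, NormalSubgroup.avoidingBasis G,
    NormalSubgroup.isTopologicalBasis_avoidingBasis,
    fun _ => NormalSubgroup.isCompact_of_mem_avoidingBasis,
    fun _ hU _ hV => NormalSubgroup.inter_mem_avoidingBasis hU hV⟩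
  obtain ⟨M, hM⟩ := NormalSubgroup.exists_closure_singleton_eq hs hc
  exact ⟨M, hM, fun N hN => NormalSubgroup.closure_singleton_injective (hN.trans hM.symm)⟩
end

section
/- Let G be a group that is the normal closure of a finitely generated subgroup of itself. Then the space 𝒩⁺(G) of proper normal subgroups of G, endowed with the coarse lower topology (as a subspace of 𝒩(G)), is quasi-compact. -/
open TopologicalSpace

/-- The (normal) subgroup of elements that eventually lie in the members of a filter of
proper normal subgroups. -/
def eventuallyMemSubgroup {G : Type*} [Group G] (F : Filter (ProperNormalSubgroup G)) :
    Subgroup G where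
  carrier := {g | ∀ᶠ M in F, g ∈ M.1.1}
  one_mem' := Filter.Eventually.of_forall fun M => M.1.1.one_mem
  mul_mem' ha hb := by
    filter_upwards [ha, hb] with M h₁ h₂ using M.1.1.mul_mem h₁ h₂
  inv_mem' ha := by
    filter_upwards [ha] with M h using M.1.1.inv_mem h

theorem mem_eventuallyMemSubgroup {G : Type*} [Group G]
    {F : Filter (ProperNormalSubgroup G)} {g : G} :
    g ∈ eventuallyMemSubgroup F ↔ ∀ᶠ M in F, g ∈ M.1.1 :=
  Iff.rfl

theorem eventuallyMemSubgroup_normal {G : Type*} [Group G]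
    (F : Filter (ProperNormalSubgroup G)) : (eventuallyMemSubgroup F).Normal where
  conj_mem a ha g := by
    rw [mem_eventuallyMemSubgroup] at ha ⊢
    filter_upwards [ha] with M h using M.1.2.conj_mem a h g

theorem eventuallyMemSubgroup_ne_top {G : Type*} [Group G]
    (hfg : ∃ T : Finset G, Subgroup.normalClosure (T : Set G) = ⊤)
    (F : Filter (ProperNormalSubgroup G)) [F.NeBot] : eventuallyMemSubgroup F ≠ ⊤ := by
  obtain ⟨T, hT⟩ := hfg
  intro htop
  have hev : ∀ᶠ M in F, ∀ g ∈ T, g ∈ M.1.1 :=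
    (Filter.eventually_all_finset T).2 fun g _ =>
      mem_eventuallyMemSubgroup.1 (htop.ge (Subgroup.mem_top g))
  obtain ⟨M, hM⟩ := hev.exists
  have := M.1.2
  exact M.2 (top_le_iff.1 (hT.ge.trans (Subgroup.normalClosure_le_normal hM)))

theorem tendsto_nhds_eventuallyMemSubgroup {G : Type*} [Group G]
    (F : Ultrafilter (ProperNormalSubgroup G)) :
    Filter.Tendsto Subtype.val (F : Filter (ProperNormalSubgroup G))
      (nhds (⟨eventuallyMemSubgroup F, eventuallyMemSubgroup_normal _⟩ : NormalSubgroup G)) := by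
  rw [tendsto_nhds_generateFrom_iff]
  rintro _ ⟨S, rfl⟩ hS
  change ¬ S.1 ≤ eventuallyMemSubgroup (F : Filter (ProperNormalSubgroup G)) at hS
  obtain ⟨g, hgS, hg⟩ := SetLike.not_le_iff_exists.1 hS
  rw [mem_eventuallyMemSubgroup, ← Ultrafilter.eventually_not] at hg
  filter_upwards [hg] with M hM hSM using hM (hSM hgS)

/-- If `G` is the normal closure of a finitely generated subgroup of itself, then
`𝒩⁺(G)` with the coarse lower topology is quasi-compact. -/
theorem properNormalSubgroups_compactSpace (G : Type*) [Group G]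
    (hfg : ∃ T : Finset G, Subgroup.normalClosure (T : Set G) = ⊤) :
    CompactSpace (ProperNormalSubgroup G) := by
  refine ⟨isCompact_iff_ultrafilter_le_nhds.2 fun F _ => ?_⟩
  refine ⟨⟨⟨eventuallyMemSubgroup F, eventuallyMemSubgroup_normal _⟩,
    eventuallyMemSubgroup_ne_top hfg F⟩, Set.mem_univ _, ?_⟩
  rw [nhds_induced, ← Filter.tendsto_iff_comap]
  exact tendsto_nhds_eventuallyMemSubgroup F
end

section
/- For any group G, the space 𝒩⁺(G) of proper normal subgroups of G, endowed with the coarse lower topology (as a subspace of 𝒩(G)), is sober: every irreducible closed subset of 𝒩⁺(G) is the closure of a unique singleton. -/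
open TopologicalSpace

theorem isClosed_VSet {G : Type*} [Group G] (S : NormalSubgroup G) : IsClosed (VSet S) :=
  ⟨isOpen_generateFrom_of_mem ⟨S, rfl⟩⟩

/-- The closure of an irreducible set is cut out by the subbasic closed sets containing it. -/
theorem IsIrreducible.mem_closure_of_forall_VSet {G : Type*} [Group G]
    {t : Set (NormalSubgroup G)} (ht : IsIrreducible t) {M : NormalSubgroup G}
    (h : ∀ S, t ⊆ VSet S → M ∈ VSet S) : M ∈ closure t := by
  rw [mem_closure_iff]
  intro U hU
  induction hU with
  | basic U hU =>
    obtain ⟨S, rfl⟩ := hU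
    intro hM
    obtain ⟨N, hN, hNS⟩ := Set.not_subset.1 (mt (h S) hM)
    exact ⟨N, hNS, hN⟩
  | univ => simpa using ht.nonempty
  | inter U V hU hV ihU ihV =>
    intro hM
    rw [Set.inter_comm]
    refine ht.isPreirreducible U V hU hV ?_ ?_
    · simpa only [Set.inter_comm] using ihU hM.1
    · simpa only [Set.inter_comm] using ihV hM.2
  | sUnion 𝒰 _ ih =>
    rintro ⟨U, hU, hM⟩
    exact (ih U hU hM).mono (Set.inter_subset_inter_left _ (Set.subset_sUnion_of_mem hU))

theorem NormalSubgroup.closure_singleton_s4 {G : Type*} [Group G] (N : NormalSubgroup G) :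
    closure {N} = VSet N := by
  refine (closure_minimal ?_ (isClosed_VSet N)).antisymm fun K hK =>
    isIrreducible_singleton.mem_closure_of_forall_VSet fun S hS => ?_
  · exact Set.singleton_subset_iff.2 (le_refl (N : Subgroup G))
  · exact le_trans (show (S : Subgroup G) ≤ N from hS rfl) hK

theorem ProperNormalSubgroup.mem_closure_singleton_s4 {G : Type*} [Group G]
    {N K : ProperNormalSubgroup G} :
    K ∈ closure {N} ↔ (N.1 : Subgroup G) ≤ K.1 := by
  rw [closure_subtype, Set.image_singleton, NormalSubgroup.closure_singleton_s4]
  rfl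

/-- For any group `G`, the space `𝒩⁺(G)` with the coarse lower topology is sober:
every irreducible closed subset is the closure of a unique point. -/
theorem properNormalSubgroups_sober (G : Type*) [Group G] :
    ∀ s : Set (ProperNormalSubgroup G), IsIrreducible s → IsClosed s →
      ∃! N : ProperNormalSubgroup G, closure {N} = s := by
  intro s hs hsc
  obtain ⟨P, hP⟩ := hs.nonempty
  let M : Subgroup G := ⨅ N : s, N.1.1.1
  have hM_le (N : ProperNormalSubgroup G) (hN : N ∈ s) : M ≤ N.1.1 :=
    iInf_le (fun N : s => N.1.1.1) ⟨N, hN⟩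
  have hM_normal : M.Normal := Subgroup.normal_iInf_normal fun N => N.1.1.2
  have hM_ne : M ≠ ⊤ := fun h => P.2 (top_le_iff.1 (h.ge.trans (hM_le P hP)))
  let M' : ProperNormalSubgroup G := ⟨⟨M, hM_normal⟩, hM_ne⟩
  have hM_mem : M' ∈ s := by
    rw [← hsc.closure_eq, closure_subtype]
    refine (hs.image _ continuous_subtype_val.continuousOn).mem_closure_of_forall_VSet
      fun S hS => ?_
    exact show (S : Subgroup G) ≤ M from le_iInf fun N : s => hS (Set.mem_image_of_mem _ N.2)
  have hM_closure : closure {M'} = s :=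
    (closure_minimal (Set.singleton_subset_iff.2 hM_mem) hsc).antisymm fun N hN =>
      ProperNormalSubgroup.mem_closure_singleton_s4.2 (hM_le N hN)
  refine ⟨M', hM_closure, fun N hN => Subtype.ext (Subtype.ext (le_antisymm ?_ ?_))⟩
  · exact ProperNormalSubgroup.mem_closure_singleton_s4.1 (hN.symm ▸ hM_mem)
  · exact hM_le N (hN ▸ subset_closure rfl)
end
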